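/- For all m,k ∈ ℤ, every α ∈ {1,…,n−1}, every i ∈ {α+1,…,n}, every smooth curve q : ℝ → U_n (i.e. with q_n nowhere zero) and every x ∈ ℝ: E_i(L^{n,m,k})[q](x) = E_{i−α}(L^{n,m+α,k−α})[q](x). -/

import Mathlib

open scoped BigOperators

/-- Coordinate of `q` with the conventions `q₀ = 1` and `q_α = 0` for `α < 0` or `α > n`
(1-based indexing by an integer). -/
def qc (n : ℕ) (q : Fin n → ℝ) (r : ℤ) : ℝ :=
  if r = 0 then 1
  else if h : 1 ≤ r ∧ r ≤ (n : ℤ) then q ⟨(r - 1).toNat, by omega⟩ else 0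

/-- The Benenti potentials `V_r^{(k)}` in `n` variables. -/
noncomputable def benenti (n : ℕ) (r k : ℤ) (q : Fin n → ℝ) : ℝ :=
  if r < 1 ∨ (n : ℤ) < r then 0
  else if k = 0 then (if r = (n : ℤ) then 1 else 0)
  else if 0 < k then
    benenti n (r + 1) (k - 1) q - qc n q r * benenti n 1 (k - 1) q
  else
    benenti n (r - 1) (k + 1) q - (qc n q (r - 1) / qc n q n) * benenti n n (k + 1) q
termination_by k.natAbs
decreasing_by all_goals omega

/-- Partial derivative of `f` with respect to the `i`-th coordinate at `q`. -/
noncomputable def pd {n : ℕ} (f : (Fin n → ℝ) → ℝ) (i : Fin n) (q : Fin n → ℝ) : ℝ :=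
  deriv (fun t => f (Function.update q i t)) (q i)

/-- Euler–Lagrange expression `E_l(L)[c](x)` of a Lagrangian density `L(q,p)`
along a curve `c`. -/
noncomputable def elExpr {n : ℕ} (L : (Fin n → ℝ) → (Fin n → ℝ) → ℝ) (l : Fin n)
    (c : ℝ → Fin n → ℝ) (x : ℝ) : ℝ :=
  pd (fun vq => L vq (deriv c x)) l (c x)
    - deriv (fun y => pd (fun vp => L (c y) vp) l (deriv c y)) x

/-- The Lagrangian density `L^{n,m,k}`. -/
noncomputable def lag (n : ℕ) (m k : ℤ) (q p : Fin n → ℝ) : ℝ :=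
  (1 / 2) * ∑ i : Fin n, ∑ j : Fin n,
      benenti n 1 (2 * (n : ℤ) - m - ((i : ℕ) + 1) - ((j : ℕ) + 1)) q * p i * p j
    - benenti n 1 k q

/-- The matrix `L` of the Benenti class in Viète coordinates. -/
def Lmat (n : ℕ) (q : Fin n → ℝ) : Matrix (Fin n) (Fin n) ℝ :=
  Matrix.of fun i j => if (j : ℕ) = 0 then -q i else if (j : ℕ) = (i : ℕ) + 1 then 1 else 0

theorem qc_zero' (n : ℕ) (q : Fin n → ℝ) : qc n q 0 = 1 := by simp [qc]

theorem qc_succ' (n : ℕ) (q : Fin n → ℝ) (j : ℕ) (h : j < n) :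
    qc n q ((j : ℤ) + 1) = q ⟨j, h⟩ := by
  unfold qc
  rw [if_neg (by omega), dif_pos (by omega)]
  congr 1
  ext
  simp

theorem ben_out (n : ℕ) (r k : ℤ) (q : Fin n → ℝ) (h : r < 1 ∨ (n : ℤ) < r) :
    benenti n r k q = 0 := by
  rw [benenti, if_pos h]

theorem ben_zero (n : ℕ) (r : ℤ) (q : Fin n → ℝ) (h1 : 1 ≤ r) (h2 : r ≤ n) :
    benenti n r 0 q = if r = (n : ℤ) then 1 else 0 := by
  rw [benenti, if_neg (by omega), if_pos rfl]

theorem ben_pos (n : ℕ) (r k : ℤ) (q : Fin n → ℝ) (h1 : 1 ≤ r) (h2 : r ≤ n) (hk : 0 < k) :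
    benenti n r k q = benenti n (r + 1) (k - 1) q - qc n q r * benenti n 1 (k - 1) q := by
  rw [benenti, if_neg (by omega), if_neg (by omega), if_pos hk]

theorem ben_neg (n : ℕ) (r k : ℤ) (q : Fin n → ℝ) (h1 : 1 ≤ r) (h2 : r ≤ n) (hk : k < 0) :
    benenti n r k q = benenti n (r - 1) (k + 1) q
      - (qc n q (r - 1) / qc n q n) * benenti n n (k + 1) q := by
  rw [benenti, if_neg (by omega), if_neg (by omega), if_neg (by omega)]

theorem ben_up (n : ℕ) (r k : ℤ) (q : Fin n → ℝ) (h1 : 1 ≤ r) (h2 : r ≤ n)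
    (hq : qc n q n ≠ 0) :
    benenti n r k q = benenti n (r + 1) (k - 1) q - qc n q r * benenti n 1 (k - 1) q := by
  by_cases hk : 0 < k
  · exact ben_pos n r k q h1 h2 hk
  · have e1 := ben_neg n 1 (k - 1) q le_rfl (by omega) (by omega)
    rw [ben_out n (1 - 1) _ q (by omega)] at e1
    simp only [sub_self, qc_zero', sub_add_cancel] at e1
    by_cases hr : r = n
    · subst hr
      rw [ben_out n (n + 1) _ q (by omega), e1]
      field_simp
      ring
    · have e2 := ben_neg n (r + 1) (k - 1) q (by omega) (by omega) (by omega)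
      simp only [add_sub_cancel_right, sub_add_cancel] at e2
      rw [e2, e1]
      field_simp
      ring

theorem ben_unroll (n : ℕ) (k : ℤ) (q : Fin n → ℝ) (hq : qc n q n ≠ 0) (s : ℕ) (hs : s ≤ n) :
    ∑ j ∈ Finset.range (s + 1), qc n q j * benenti n 1 (k + s - j) q
      = if s = 0 then benenti n 1 k q else benenti n (s + 1) k q := by
  induction s generalizing k with
  | zero => simp [qc_zero']
  | succ s ih =>
    rw [Finset.sum_range_succ]
    have h := ih (k + 1) (by omega)
    have h' : ∑ j ∈ Finset.range (s + 1), qc n q j * benenti n 1 (k + (s + 1 : ℕ) - j) q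
        = benenti n (s + 1) (k + 1) q := by
      convert h using 1
      · apply Finset.sum_congr rfl
        intro j _
        congr 2
        push_cast; ring
      · split_ifs with h0
        · subst h0; simp
        · rfl
    rw [h', ben_up n (s + 1) (k + 1) q (by omega) (by omega) hq, if_neg (by omega)]
    push_cast
    simp

theorem ben_rec (n : ℕ) (hn : 1 ≤ n) (k : ℤ) (q : Fin n → ℝ) (hq : qc n q n ≠ 0) :
    ∑ j ∈ Finset.range (n + 1), qc n q j * benenti n 1 (k + n - j) q = 0 := by
  rw [ben_unroll n k q hq n le_rfl, if_neg (by omega), ben_out n _ _ q (by omega)]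

theorem ben_init (n : ℕ) (s : ℕ) (hs : s + 1 ≤ n) (r : ℤ) (h1 : 1 ≤ r) (h2 : r ≤ n)
    (q : Fin n → ℝ) :
    r + s ≤ n → benenti n r s q = if r + s = (n : ℤ) then 1 else 0 := by
  induction s generalizing r with
  | zero => intro _; simpa using ben_zero n r q h1 h2
  | succ s ih =>
    intro hrs
    rw [ben_pos n r _ q h1 h2 (by omega)]
    have e : ((s + 1 : ℕ) : ℤ) - 1 = s := by push_cast; ring
    rw [e, ih (by omega) (r + 1) (by omega) (by omega) (by omega),
      ih (by omega) 1 (by omega) (by omega) (by omega), if_neg (c := (1 + (s : ℤ) = n)) (by omega)]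
    have : (r + 1 + (s : ℤ) = n) ↔ (r + ((s + 1 : ℕ) : ℤ) = n) := by omega
    simp only [this]
    simp

theorem rec_unique (n : ℕ) (hn : 1 ≤ n) (a : ℕ → ℝ) (h0 : a 0 = 1) (han : a n ≠ 0)
    (d : ℤ → ℝ) (hd : ∀ k : ℤ, ∑ j ∈ Finset.range (n + 1), a j * d (k + n - j) = 0)
    (k0 : ℤ) (hi : ∀ s : ℕ, s < n → d (k0 + s) = 0) (k : ℤ) : d k = 0 := by
  have up : ∀ t : ℕ, ∀ s : ℕ, s < n → d (k0 + t + s) = 0 := by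
    intro t
    induction t with
    | zero => simpa using hi
    | succ t ih =>
      intro s hs
      by_cases hs' : s + 1 < n
      · have := ih (s + 1) hs'
        rw [← this]; congr 1; push_cast; ring
      · have h := hd (k0 + t)
        rw [Finset.sum_range_succ', Finset.sum_eq_zero] at h
        · simp only [h0, one_mul, zero_add] at h
          rw [← h]; congr 1; push_cast; omega
        · intro j hj
          have hj := Finset.mem_range.1 hj
          have := ih (n - (j + 1)) (by omega)
          have e : k0 + t + n - ((j + 1 : ℕ) : ℤ) = k0 + t + ((n - (j + 1) : ℕ) : ℤ) := by omega
          rw [e, this, mul_zero]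
  have down : ∀ t : ℕ, ∀ s : ℕ, s < n → d (k0 - t + s) = 0 := by
    intro t
    induction t with
    | zero => simpa using hi
    | succ t ih =>
      intro s hs
      by_cases hs' : 0 < s
      · have := ih (s - 1) (by omega)
        rw [← this]; congr 1; omega
      · have h := hd (k0 - (t + 1 : ℕ))
        rw [Finset.sum_range_succ, Finset.sum_eq_zero] at h
        · rw [zero_add] at h
          have h := (mul_eq_zero.1 h).resolve_left han
          rw [← h]; congr 1; omega
        · intro j hj
          have hj := Finset.mem_range.1 hj
          have := ih (n - 1 - j) (by omega)
          have e : k0 - ((t + 1 : ℕ) : ℤ) + n - (j : ℤ) = k0 - t + ((n - 1 - j : ℕ) : ℤ) := by omega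
          rw [e, this, mul_zero]
  by_cases hk : k0 ≤ k
  · have := up (k - k0).toNat 0 (by omega)
    rw [← this]; congr 1; omega
  · have := down (k0 - k).toNat 0 (by omega)
    rw [← this]; congr 1; omega

theorem qc_hasDeriv (n : ℕ) (q : Fin n → ℝ) (l : Fin n) (j : ℤ) (t : ℝ) :
    HasDerivAt (fun t => qc n (Function.update q l t) j)
      (if j = (l : ℕ) + 1 then 1 else 0) t := by
  unfold qc
  by_cases h0 : j = 0
  · simp only [h0, if_true]
    rw [if_neg (by omega)]
    exact hasDerivAt_const _ _
  · simp only [h0, if_false]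
    by_cases h : 1 ≤ j ∧ j ≤ (n : ℤ)
    · simp only [h, and_self, dif_pos]
      by_cases hl : j = (l : ℕ) + 1
      · have : (⟨(j - 1).toNat, by omega⟩ : Fin n) = l := by ext; simp; omega
        rw [if_pos hl]
        simp only [this, Function.update_self]
        exact hasDerivAt_id t
      · have : (⟨(j - 1).toNat, by omega⟩ : Fin n) ≠ l := by
          intro e; rw [Fin.ext_iff] at e; simp at e; omega
        simp only [ne_eq, this, not_false_eq_true, Function.update_of_ne, hl, if_false]
        exact hasDerivAt_const _ _
    · simp only [h, dif_neg, not_false_eq_true]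
      rw [if_neg (by omega)]
      exact hasDerivAt_const _ _

theorem ben_diff (n : ℕ) (q : Fin n → ℝ) (l : Fin n) (hq : qc n q n ≠ 0) (N : ℕ) :
    ∀ r k : ℤ, k.natAbs ≤ N →
    DifferentiableAt ℝ (fun t => benenti n r k (Function.update q l t)) (q l) := by
  induction N with
  | zero =>
    intro r k hk
    have : k = 0 := by omega
    subst this
    by_cases h : r < 1 ∨ (n : ℤ) < r
    · simp only [ben_out n r _ _ h]; exact differentiableAt_const _
    · simp only [ben_zero n r _ (by omega : 1 ≤ r) (by omega)]; exact differentiableAt_const _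
  | succ N ih =>
    intro r k hk
    by_cases hk' : k.natAbs ≤ N
    · exact ih r k hk'
    by_cases h : r < 1 ∨ (n : ℤ) < r
    · simp only [ben_out n r _ _ h]; exact differentiableAt_const _
    have dq : ∀ j, DifferentiableAt ℝ (fun t => qc n (Function.update q l t) j) (q l) :=
      fun j => (qc_hasDeriv n q l j _).differentiableAt
    by_cases hp : 0 < k
    · simp only [ben_pos n r k _ (by omega : 1 ≤ r) (by omega) hp]
      exact (ih _ _ (by omega)).sub ((dq _).mul (ih _ _ (by omega)))
    · simp only [ben_neg n r k _ (by omega : 1 ≤ r) (by omega) (by omega)]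
      refine (ih _ _ (by omega)).sub (((dq _).div (dq _) ?_).mul (ih _ _ (by omega)))
      simpa using hq

theorem pd_rec (n : ℕ) (hn : 1 ≤ n) (q : Fin n → ℝ) (l : Fin n) (hq : qc n q n ≠ 0) (k : ℤ) :
    benenti n 1 (k + n - ((l : ℕ) + 1)) q
      + ∑ j ∈ Finset.range (n + 1), qc n q j * pd (benenti n 1 (k + n - j)) l q = 0 := by
  have hb : ∀ k, HasDerivAt (fun t => benenti n 1 k (Function.update q l t))
      (pd (benenti n 1 k) l q) (q l) :=
    fun k => (ben_diff n q l hq k.natAbs 1 k le_rfl).hasDerivAt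
  have h1 := HasDerivAt.fun_sum (u := Finset.range (n + 1))
    (fun (j : ℕ) _ => (qc_hasDeriv n q l j (q l)).mul (hb (k + n - j)))
  have h2 : HasDerivAt (fun t => ∑ j ∈ Finset.range (n + 1),
      qc n (Function.update q l t) j * benenti n 1 (k + n - j) (Function.update q l t)) 0 (q l) := by
    have hne : ∀ᶠ t in nhds (q l), qc n (Function.update q l t) n ≠ 0 := by
      apply (qc_hasDeriv n q l n (q l)).continuousAt.eventually_ne
      simpa using hq
    apply (hasDerivAt_const (q l) (0 : ℝ)).congr_of_eventuallyEq
    filter_upwards [hne] with t ht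
    exact ben_rec n hn k _ ht
  have h3 := h1.unique h2
  rw [← h3]
  simp only [Function.update_eq_self, Finset.sum_add_distrib]
  congr 1
  rw [Finset.sum_eq_single ((l : ℕ) + 1)]
  · simp
  · intro b _ hb
    rw [if_neg (by omega), zero_mul]
  · intro h
    have := l.2
    simp at h

theorem pd_init (n : ℕ) (q : Fin n → ℝ) (l : Fin n) (s : ℕ) (hs : s + 1 ≤ n) :
    pd (benenti n 1 s) l q = 0 := by
  unfold pd
  simp only [ben_init n s hs 1 le_rfl (by omega) _ (by omega)]
  simp

theorem pd_shift1 (n : ℕ) (q : Fin n → ℝ) (hq : qc n q n ≠ 0) (l : ℕ) (hl : l + 1 < n) (k : ℤ) :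
    pd (benenti n 1 k) ⟨l + 1, hl⟩ q = pd (benenti n 1 (k - 1)) ⟨l, by omega⟩ q := by
  rw [← sub_eq_zero]
  refine rec_unique n (by omega) (fun j => qc n q j) (qc_zero' n q) hq
    (fun k => pd (benenti n 1 k) ⟨l + 1, hl⟩ q - pd (benenti n 1 (k - 1)) ⟨l, by omega⟩ q)
    ?_ 1 ?_ k
  · intro k
    have h1 := pd_rec n (by omega) q ⟨l + 1, hl⟩ hq k
    have h2 := pd_rec n (by omega) q ⟨l, by omega⟩ hq (k - 1)
    simp only at h1 h2
    have e : k - 1 + (n : ℤ) - ((l : ℤ) + 1) = k + n - (((l + 1 : ℕ) : ℤ) + 1) := by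
      push_cast; ring
    rw [e] at h2
    have e2 : ∀ j : ℕ, k - 1 + (n : ℤ) - (j : ℤ) = k + n - j - 1 := by intro j; ring
    simp only [e2] at h2
    simp only [mul_sub, Finset.sum_sub_distrib]
    linarith
  · intro s hs
    have z : pd (benenti n 1 (1 + (s : ℤ) - 1)) ⟨l, by omega⟩ q = 0 := by
      rw [add_sub_cancel_left]; exact pd_init n q _ s hs
    simp only [z, sub_zero]
    by_cases hs' : s + 1 < n
    · have := pd_init n q ⟨l + 1, hl⟩ (s + 1) hs'
      rw [← this]; congr 2; push_cast; ring
    · have h := pd_rec n (by omega) q ⟨l + 1, hl⟩ hq 0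
      have hb := ben_init n (n - (l + 2)) (by omega) 1 le_rfl (by omega) q (by omega)
      rw [if_neg (by omega)] at hb
      have e : (0 : ℤ) + n - (((l + 1 : ℕ) : ℤ) + 1) = ((n - (l + 2) : ℕ) : ℤ) := by omega
      simp only [] at h
      rw [e, hb, Finset.sum_range_succ', Finset.sum_eq_zero] at h
      · simp only [Nat.cast_zero, qc_zero', one_mul, zero_add, sub_zero] at h
        rw [← h]; congr 2; omega
      · intro j hj
        have hj := Finset.mem_range.1 hj
        have e3 : (0 : ℤ) + n - ((j + 1 : ℕ) : ℤ) = ((n - (j + 1) : ℕ) : ℤ) := by omega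
        rw [e3, pd_init n q _ _ (by omega), mul_zero]

theorem pd_shift (n : ℕ) (q : Fin n → ℝ) (hq : qc n q n ≠ 0) (a : ℕ) (l : ℕ) (hl : l + a < n)
    (k : ℤ) :
    pd (benenti n 1 k) ⟨l + a, hl⟩ q = pd (benenti n 1 (k - a)) ⟨l, by omega⟩ q := by
  induction a generalizing k with
  | zero => simp
  | succ a ih =>
    have h1 := pd_shift1 n q hq (l + a) (by omega) k
    have h2 := ih (by omega) (k - 1)
    have e : k - 1 - (a : ℤ) = k - ((a + 1 : ℕ) : ℤ) := by push_cast; ring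
    rw [e] at h2
    exact h1.trans h2

theorem pd_lag_q (n : ℕ) (m k : ℤ) (q p : Fin n → ℝ) (hq : qc n q n ≠ 0) (l : Fin n) :
    pd (fun vq => lag n m k vq p) l q
      = (1 / 2) * ∑ i : Fin n, ∑ j : Fin n,
        pd (benenti n 1 (2 * (n : ℤ) - m - ((i : ℕ) + 1) - ((j : ℕ) + 1))) l q * p i * p j
        - pd (benenti n 1 k) l q := by
  have hb : ∀ k, HasDerivAt (fun t => benenti n 1 k (Function.update q l t))
      (pd (benenti n 1 k) l q) (q l) :=
    fun k => (ben_diff n q l hq k.natAbs 1 k le_rfl).hasDerivAt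
  apply HasDerivAt.deriv
  unfold lag
  refine HasDerivAt.sub (HasDerivAt.const_mul _ ?_) (hb k)
  refine HasDerivAt.fun_sum fun i _ => HasDerivAt.fun_sum fun j _ => ?_
  exact ((hb _).mul_const _).mul_const _

theorem pd_lag_p (n : ℕ) (m k : ℤ) (q p : Fin n → ℝ) (l : Fin n) :
    pd (fun vp => lag n m k q vp) l p
      = ∑ j : Fin n, benenti n 1 (2 * (n : ℤ) - m - ((l : ℕ) + 1) - ((j : ℕ) + 1)) q * p j := by
  have hu : ∀ j : Fin n, HasDerivAt (fun t => Function.update p l t j)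
      (if j = l then 1 else 0) (p l) := by
    intro j
    by_cases h : j = l
    · subst h; simpa using hasDerivAt_id' (p j)
    · simpa [h] using hasDerivAt_const (p l) (p j)
  unfold pd lag
  have H := ((HasDerivAt.fun_sum (u := Finset.univ) fun (i : Fin n) _ =>
    HasDerivAt.fun_sum (u := Finset.univ) fun (j : Fin n) _ =>
      ((hu i).const_mul (benenti n 1 (2 * (n : ℤ) - m - ((i : ℕ) + 1) - ((j : ℕ) + 1)) q)).mul
        (hu j)).const_mul (1 / 2 : ℝ)).sub_const (benenti n 1 k q)
  refine H.deriv.trans ?_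
  simp only [Function.update_eq_self, Finset.sum_add_distrib]
  have A : ∑ i : Fin n, ∑ j : Fin n,
      benenti n 1 (2 * (n : ℤ) - m - ((i : ℕ) + 1) - ((j : ℕ) + 1)) q
        * (if i = l then 1 else 0) * p j
      = ∑ j : Fin n, benenti n 1 (2 * (n : ℤ) - m - ((l : ℕ) + 1) - ((j : ℕ) + 1)) q * p j := by
    rw [Finset.sum_eq_single l]
    · simp
    · intro b _ hb; simp [hb]
    · simp
  have B : ∑ i : Fin n, ∑ j : Fin n,
      benenti n 1 (2 * (n : ℤ) - m - ((i : ℕ) + 1) - ((j : ℕ) + 1)) q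
        * p i * (if j = l then 1 else 0)
      = ∑ j : Fin n, benenti n 1 (2 * (n : ℤ) - m - ((l : ℕ) + 1) - ((j : ℕ) + 1)) q * p j := by
    apply Finset.sum_congr rfl
    intro i _
    rw [Finset.sum_eq_single l]
    · rw [if_pos rfl, mul_one]; congr 2; ring
    · intro b _ hb; simp [hb]
    · simp
  rw [A, B]
  ring


/-- for all `m,k ∈ ℤ`, `α ∈ {1,…,n−1}`, `i ∈ {α+1,…,n}`, every smooth
curve `q : ℝ → U_n` and every `x`: `E_i(L^{n,m,k})[q](x) = E_{i−α}(L^{n,m+α,k−α})[q](x)`. -/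
theorem el_shift_invariance
    (n : ℕ) (hn : 1 ≤ n) (m k : ℤ) (α : ℕ) (hα1 : 1 ≤ α) (hα2 : α ≤ n - 1)
    (i : ℕ) (hi1 : α + 1 ≤ i) (hi2 : i ≤ n)
    (c : ℝ → Fin n → ℝ) (hc : ContDiff ℝ (⊤ : ℕ∞) c)
    (hcU : ∀ x : ℝ, c x ⟨n - 1, by omega⟩ ≠ 0) (x : ℝ) :
    elExpr (lag n m k) ⟨i - 1, by omega⟩ c x
      = elExpr (lag n (m + α) (k - α)) ⟨i - α - 1, by omega⟩ c x := by
  obtain ⟨l, rfl⟩ : ∃ l, i = l + α + 1 := ⟨i - α - 1, by omega⟩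
  have hq : ∀ y, qc n (c y) n ≠ 0 := by
    intro y
    have h := qc_succ' n (c y) (n - 1) (by omega)
    have e : ((n - 1 : ℕ) : ℤ) + 1 = n := by omega
    rw [e] at h
    rw [h]; exact hcU y
  have e1 : (⟨l + α + 1 - 1, by omega⟩ : Fin n) = ⟨l + α, by omega⟩ := by ext; simp
  have e2 : (⟨l + α + 1 - α - 1, by omega⟩ : Fin n) = ⟨l, by omega⟩ := by ext; simp; omega
  rw [e1, e2]
  unfold elExpr
  congr 1
  · rw [pd_lag_q n m k _ _ (hq x), pd_lag_q n _ _ _ _ (hq x), pd_shift n _ (hq x) α l (by omega) k]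
    congr 2
    refine Finset.sum_congr rfl fun i _ => Finset.sum_congr rfl fun j _ => ?_
    rw [pd_shift n _ (hq x) α l (by omega)]
    congr 4
    ring
  · congr 1
    funext y
    rw [pd_lag_p, pd_lag_p]
    refine Finset.sum_congr rfl fun j _ => ?_
    congr 2
    push_cast
    ring
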